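/- Let n ≥ 1 and let A be an irreducible ℝ-subalgebra of M_n(ℍ). Then A contains a matrix of rank one (i.e., a nonzero matrix whose image {Ax : x ∈ ℍⁿ} is a one-dimensional right ℍ-subspace of ℍⁿ), and either A = M_n(ℍ), or there is an invertible P ∈ M_n(ℍ) with P⁻¹AP equal to the set of matrices in M_n(ℍ) all of whose entries lie in the subring ℝ + ℝi of ℍ (a copy of ℂ), or there is an invertible P ∈ M_n(ℍ) with P⁻¹AP equal to the set of matrices in M_n(ℍ) all of whose entries are real. -/

import Mathlib

set_option synthInstance.maxHeartbeats 1000000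
section
open TensorProduct Quaternion Matrix MulOpposite


theorem exists_real_or_imaginary_unit {D : Type*} [Ring D] [IsDomain D] [Algebra ℝ D]
    [Algebra.IsIntegral ℝ D] (x : D) :
    (∃ a : ℝ, x = algebraMap ℝ D a) ∨
      ∃ (a r : ℝ) (y : D), r ≠ 0 ∧ y * y = -1 ∧ x = algebraMap ℝ D a + r • y := by
  have hx : IsIntegral ℝ x := Algebra.IsIntegral.isIntegral x
  have hirr := minpoly.irreducible hx
  obtain ⟨a, s, h⟩ : ∃ a s : ℝ,
      (x - algebraMap ℝ D a) * (x - algebraMap ℝ D a) = algebraMap ℝ D s := by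
    have hdeg := hirr.natDegree_le_two
    have hpos := minpoly.natDegree_pos hx
    have hm := minpoly.monic hx
    have h0 := minpoly.aeval ℝ x
    rw [Polynomial.aeval_eq_sum_range] at h0
    have hcases : (minpoly ℝ x).natDegree = 1 ∨ (minpoly ℝ x).natDegree = 2 := by omega
    have hl := hm.coeff_natDegree
    rcases hcases with hd | hd
    · rw [hd] at h0 hl
      refine ⟨-(minpoly ℝ x).coeff 0, 0, ?_⟩
      simp [Finset.sum_range_succ, hl, Algebra.smul_def] at h0
      simp [add_comm x, h0]
    · rw [hd] at h0 hl
      set b := (minpoly ℝ x).coeff 1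
      set c := (minpoly ℝ x).coeff 0
      refine ⟨-b / 2, b ^ 2 / 4 - c, ?_⟩
      simp only [Finset.sum_range_succ, hl, Finset.sum_range_zero, zero_add, pow_zero,
        pow_one, one_smul] at h0
      have hxx : x * x = -(c • (1 : D) + b • x) := by
        rw [← pow_two]; exact eq_neg_of_add_eq_zero_right h0
      simp only [sub_mul, mul_sub, hxx, Algebra.algebraMap_eq_smul_one, smul_mul_assoc,
        mul_smul_comm, one_mul, mul_one]
      module
  rcases le_or_gt 0 s with hs | hs
  · left
    have : (x - algebraMap ℝ D a - algebraMap ℝ D √s) *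
        (x - algebraMap ℝ D a + algebraMap ℝ D √s) = 0 := by
      have hc := Algebra.commutes √s (x - algebraMap ℝ D a)
      rw [sub_mul, mul_add, mul_add, h, hc, ← map_mul, Real.mul_self_sqrt hs]
      abel
    rcases mul_eq_zero.1 this with h | h
    · exact ⟨a + √s, by rw [map_add, ← sub_eq_zero, ← h]; abel⟩
    · exact ⟨a - √s, by rw [map_sub, ← sub_eq_zero, ← h]; abel⟩
  · right
    have hr : √(-s) ≠ 0 := (Real.sqrt_pos.2 (neg_pos.2 hs)).ne'
    refine ⟨a, √(-s), (√(-s))⁻¹ • (x - algebraMap ℝ D a), hr, ?_, ?_⟩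
    · rw [smul_mul_smul_comm, h, Algebra.algebraMap_eq_smul_one, smul_smul, ← mul_inv,
        Real.mul_self_sqrt (neg_pos.2 hs).le, inv_neg, neg_mul, inv_mul_cancel₀ hs.ne, neg_smul,
        one_smul]
    · rw [smul_inv_smul₀ hr]; abel

theorem eq_real_add_smul_of_commute {D : Type*} [Ring D] [IsDomain D] [Algebra ℝ D]
    [Algebra.IsIntegral ℝ D] {J x : D} (hJ : J * J = -1) (hx : J * x = x * J) :
    ∃ a b : ℝ, x = algebraMap ℝ D a + b • J := by
  rcases exists_real_or_imaginary_unit x with ⟨a, rfl⟩ | ⟨a, r, y, hr, hy, rfl⟩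
  · exact ⟨a, 0, by simp⟩
  · have hc : J * y = y * J := by
      rw [mul_add, add_mul, ← Algebra.commutes, add_right_inj, mul_smul_comm, smul_mul_assoc] at hx
      exact smul_right_injective D hr hx
    have : (y - J) * (y + J) = 0 := by
      rw [sub_mul, mul_add, mul_add, hy, hJ, hc]; abel
    rcases mul_eq_zero.1 this with h | h
    · exact ⟨a, r, by rw [sub_eq_zero.1 h]⟩
    · exact ⟨a, -r, by rw [eq_neg_of_add_eq_zero_left h, smul_neg, neg_smul]⟩

/-- Frobenius' theorem on finite-dimensional real division algebras, in terms of generators. -/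
theorem frobenius_generators (D : Type*) [Ring D] [IsDomain D] [Algebra ℝ D]
    [Algebra.IsIntegral ℝ D] :
    (∀ x : D, ∃ a : ℝ, x = algebraMap ℝ D a) ∨
    (∃ J : D, J * J = -1 ∧ ∀ x : D, ∃ a b : ℝ, x = algebraMap ℝ D a + b • J) ∨
    (∃ J K : D, J * J = -1 ∧ K * K = -1 ∧ J * K = -(K * J) ∧
      ∀ x : D, ∃ a b c d : ℝ, x = algebraMap ℝ D a + b • J + c • K + d • (K * J)) := by
  by_cases h1 : ∀ x : D, ∃ a : ℝ, x = algebraMap ℝ D a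
  · exact .inl h1
  right
  push Not at h1
  obtain ⟨x₀, hx₀⟩ := h1
  obtain ⟨J, hJ⟩ : ∃ J : D, J * J = -1 := by
    rcases exists_real_or_imaginary_unit x₀ with ⟨a, h⟩ | ⟨a, r, y, hr, hy, -⟩
    · exact (hx₀ a h).elim
    · exact ⟨y, hy⟩
  have hJ0 : J ≠ 0 := by rintro rfl; simp at hJ
  by_cases h2 : ∀ z : D, J * z = -(z * J) → z = 0
  · refine .inl ⟨J, hJ, fun x => eq_real_add_smul_of_commute hJ ?_⟩
    rw [← sub_eq_zero]
    apply h2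
    rw [mul_sub, sub_mul, ← mul_assoc, hJ, mul_assoc x, hJ, mul_assoc]
    simp [sub_eq_add_neg]
  right
  push Not at h2
  obtain ⟨z, hz, hz0⟩ := h2
  have two : ∀ w : D, w = -w → w = 0 := fun w hw => by
    have : (2 : ℝ) • w = 0 := by rw [two_smul]; nth_rw 2 [hw]; simp
    simpa using this
  obtain ⟨K, hK, hJK⟩ : ∃ K : D, K * K = -1 ∧ J * K = -(K * J) := by
    rcases exists_real_or_imaginary_unit z with ⟨a, rfl⟩ | ⟨a, r, y, hr, hy, rfl⟩
    · rw [← Algebra.commutes] at hz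
      have := two _ hz
      rcases mul_eq_zero.1 this with h | h
      · exact (hz0 h).elim
      · exact (hJ0 h).elim
    · refine ⟨y, hy, ?_⟩
      have hsq : J * ((algebraMap ℝ D a + r • y) * (algebraMap ℝ D a + r • y)) =
          ((algebraMap ℝ D a + r • y) * (algebraMap ℝ D a + r • y)) * J := by
        rw [← mul_assoc, hz, neg_mul, mul_assoc, hz, mul_neg, neg_neg, mul_assoc]
      have e : (algebraMap ℝ D a + r • y) * (algebraMap ℝ D a + r • y) =
          algebraMap ℝ D (-a * a - r * r) + (2 * a) • (algebraMap ℝ D a + r • y) := by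
        simp only [add_mul, mul_add, Algebra.algebraMap_eq_smul_one, smul_mul_assoc,
          mul_smul_comm, one_mul, mul_one, hy]
        module
      have ha : a = 0 := by
        rw [e, mul_add, add_mul, ← Algebra.commutes, add_right_inj, mul_smul_comm, smul_mul_assoc,
          hz, smul_neg, eq_comm] at hsq
        have h0 := two _ hsq
        rcases smul_eq_zero.1 h0 with h0 | h0
        · linarith
        · exact (mul_ne_zero hz0 hJ0 h0).elim
      rw [ha, map_zero, zero_add, mul_smul_comm, smul_mul_assoc, ← smul_neg] at hz
      exact smul_right_injective D hr hz
  refine ⟨J, K, hJ, hK, hJK, fun x => ?_⟩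
  obtain ⟨a, b, hu⟩ := eq_real_add_smul_of_commute hJ (x := x - J * x * J) (by
    simp only [mul_sub, sub_mul, ← mul_assoc, hJ]
    simp only [mul_assoc, hJ]
    simp [add_comm])
  obtain ⟨c, d, hv⟩ := eq_real_add_smul_of_commute hJ (x := K * (x + J * x * J)) (by
    rw [← mul_assoc, hJK]
    simp only [mul_add, add_mul, ← mul_assoc, neg_mul]
    simp only [mul_assoc, hJ]
    simp [add_comm])
  have hv' : x + J * x * J = -(K * (algebraMap ℝ D c + d • J)) := by
    rw [← hv, ← mul_assoc, hK]; simp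
  refine ⟨a / 2, b / 2, -c / 2, -d / 2, ?_⟩
  have : x = (1 / 2 : ℝ) • ((x - J * x * J) + (x + J * x * J)) := by module
  rw [this, hu, hv']
  simp only [mul_add, Algebra.algebraMap_eq_smul_one, mul_smul_comm, mul_one]
  module


/-- The quaternion unit `i`. -/
@[simps] def quaternionI : ℍ[ℝ] := ⟨0, 1, 0, 0⟩

/-- The quaternion unit `j`. -/
@[simps] def quaternionJ : ℍ[ℝ] := ⟨0, 0, 1, 0⟩

/-- The quaternion unit `k`. -/
@[simps] def quaternionK : ℍ[ℝ] := ⟨0, 0, 0, 1⟩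

theorem sum_mul_mul_star_quaternion (p : ℍ[ℝ]) :
    p + quaternionI * p * star quaternionI + quaternionJ * p * star quaternionJ +
      quaternionK * p * star quaternionK = (((4 * p.re : ℝ)) : ℍ[ℝ]) := by
  ext
  · simp
    ring
  all_goals simp

theorem exists_matrix_eq_of_right_linear {n : ℕ} (φ : (Fin n → ℍ[ℝ]) →ₗ[ℍ[ℝ]ᵐᵒᵖ] (Fin n → ℍ[ℝ])) :
    ∃ X : Matrix (Fin n) (Fin n) ℍ[ℝ], ∀ v, φ v = X *ᵥ v := by
  refine ⟨Matrix.of fun i j => φ (Pi.single j 1) i, fun v => ?_⟩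
  have hv : v = ∑ j, op (v j) • (Pi.single j 1 : Fin n → ℍ[ℝ]) := by
    ext1 i
    simp [Finset.sum_apply, Pi.single_apply]
  conv_lhs => rw [hv]
  ext1 i
  simp [mulVec, dotProduct]

section Bimodule

variable {B H V : Type*} [Ring B] [Algebra ℝ B] [Ring H] [Algebra ℝ H] [AddCommGroup V]
  [Module ℝ V] [Module B V] [Module H V] [IsScalarTower ℝ B V] [IsScalarTower ℝ H V]
  [SMulCommClass B H V]

attribute [local instance] TensorProduct.Algebra.module

theorem isSimpleModule_tensorProduct [Nontrivial V]
    (hirr : ∀ W : Submodule H V, (∀ b : B, ∀ x ∈ W, b • x ∈ W) → W = ⊥ ∨ W = ⊤) :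
    IsSimpleModule (B ⊗[ℝ] H) V := by
  rw [isSimpleModule_iff]
  refine { exists_pair_ne := ⟨⊥, ⊤, bot_ne_top⟩, eq_bot_or_eq_top := fun W => ?_ }
  have h := hirr
    { carrier := W
      add_mem' := W.add_mem
      zero_mem' := W.zero_mem
      smul_mem' := fun q x hx => by
        have := W.smul_mem ((1 : B) ⊗ₜ[ℝ] q) hx
        rwa [TensorProduct.Algebra.smul_def, one_smul] at this }
    (fun b x hx => by
      have := W.smul_mem (b ⊗ₜ[ℝ] (1 : H)) hx
      rwa [TensorProduct.Algebra.smul_def, one_smul] at this)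
  refine h.imp (fun h => ?_) (fun h => ?_)
  · ext x; simpa using SetLike.ext_iff.1 h x
  · ext x; simpa using SetLike.ext_iff.1 h x

/-- The Jacobson density theorem for a simple bimodule, in elementary terms. -/
theorem exists_moduleAux_eq [Nontrivial V]
    (hirr : ∀ W : Submodule H V, (∀ b : B, ∀ x ∈ W, b • x ∈ W) → W = ⊥ ∨ W = ⊤)
    (f : V →+ V)
    (hf : ∀ φ : V →ₗ[H] V, (∀ (b : B) v, φ (b • v) = b • φ v) → ∀ v, f (φ v) = φ (f v))
    (s : Finset V) :
    ∃ r : B ⊗[ℝ] H, ∀ v ∈ s, f v = TensorProduct.Algebra.moduleAux r v := by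
  have := isSimpleModule_tensorProduct hirr
  exact jacobson_density (R := B ⊗[ℝ] H) (M := V)
    { toFun := f
      map_add' := f.map_add
      map_smul' := fun φ v => hf
        { toFun := φ
          map_add' := φ.map_add
          map_smul' := fun q x => by
            have := φ.map_smul ((1 : B) ⊗ₜ[ℝ] q) x
            rwa [TensorProduct.Algebra.smul_def, one_smul, TensorProduct.Algebra.smul_def,
              one_smul] at this }
        (fun b x => by
          have := φ.map_smul (b ⊗ₜ[ℝ] (1 : H)) x
          rwa [TensorProduct.Algebra.smul_def, one_smul, TensorProduct.Algebra.smul_def,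
            one_smul] at this) v } s

end Bimodule

open TensorProduct.Algebra in
theorem exists_mem_sum_smul {n : ℕ} (B : Subalgebra ℝ (Matrix (Fin n) (Fin n) ℍ[ℝ]))
    (r : B ⊗[ℝ] ℍ[ℝ]ᵐᵒᵖ) :
    ∃ b ∈ B, ∀ x : Fin n → ℍ[ℝ],
      moduleAux r x + op (star quaternionI) • moduleAux r (op quaternionI • x) +
        op (star quaternionJ) • moduleAux r (op quaternionJ • x) +
        op (star quaternionK) • moduleAux r (op quaternionK • x) = b *ᵥ x := by
  induction r with
  | zero => exact ⟨0, B.zero_mem, fun x => by simp⟩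
  | add r s hr hs =>
    obtain ⟨b, hb, hb'⟩ := hr
    obtain ⟨c, hc, hc'⟩ := hs
    refine ⟨b + c, B.add_mem hb hc, fun x => ?_⟩
    rw [add_mulVec, ← hb', ← hc']
    simp only [map_add, LinearMap.add_apply, smul_add]
    abel
  | tmul b p =>
    refine ⟨(4 * p.unop.re) • b.1, B.smul_mem b.2 _, fun x => ?_⟩
    have key1 : ∀ y : Fin n → ℍ[ℝ], moduleAux (b ⊗ₜ[ℝ] p) y = b.1 *ᵥ (p • y) :=
      fun y => moduleAux_apply b p y
    have key : ∀ q q' : ℍ[ℝ], op q' • (b.1 *ᵥ (p • op q • x)) =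
        b.1 *ᵥ (op (q * p.unop * q') • x) := fun q q' => by
      rw [← mulVec_smul, smul_smul, smul_smul, op_mul, op_mul, op_unop, mul_assoc]
    rw [key1, key1, key1, key1, key, key, key, ← mulVec_add, ← mulVec_add, ← mulVec_add,
      ← op_unop p, ← add_smul, ← add_smul, ← add_smul, ← op_add, ← op_add, ← op_add, op_unop,
      sum_mul_mul_star_quaternion, smul_mulVec, ← mulVec_smul]
    congr 1
    ext1 i
    simp only [Pi.smul_apply, op_smul_eq_mul, Quaternion.mul_coe_eq_smul]

/-- Over an irreducible algebra of matrices, the action of a matrix in the double centralizer is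
that of an element of the enveloping algebra on finitely many vectors. -/
theorem exists_moduleAux_eq_mulVec {n : ℕ} (hn : 1 ≤ n)
    (B : Subalgebra ℝ (Matrix (Fin n) (Fin n) ℍ[ℝ]))
    (hirr : ∀ W : Submodule ℍ[ℝ]ᵐᵒᵖ (Fin n → ℍ[ℝ]),
      (∀ A ∈ B, ∀ x ∈ W, A *ᵥ x ∈ W) → W = ⊥ ∨ W = ⊤)
    (T : Matrix (Fin n) (Fin n) ℍ[ℝ])
    (hT : ∀ X, (∀ b ∈ B, b * X = X * b) → T * X = X * T) (s : Finset (Fin n → ℍ[ℝ])) :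
    ∃ r : B ⊗[ℝ] ℍ[ℝ]ᵐᵒᵖ, ∀ v ∈ s, T *ᵥ v = TensorProduct.Algebra.moduleAux r v := by
  have : Nonempty (Fin n) := ⟨⟨0, hn⟩⟩
  refine exists_moduleAux_eq (B := B) (H := ℍ[ℝ]ᵐᵒᵖ) (fun W hW => hirr W fun A hA => hW ⟨A, hA⟩)
    ⟨⟨fun v => T *ᵥ v, mulVec_zero T⟩, mulVec_add T⟩ (fun φ hφ v => ?_) s
  obtain ⟨X, hX⟩ := exists_matrix_eq_of_right_linear φ
  have hc : T * X = X * T := by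
    refine hT X fun b hb => Matrix.ext_iff_mulVec.2 fun v => ?_
    have := hφ ⟨b, hb⟩ v
    rw [hX, hX] at this
    rw [← mulVec_mulVec, ← mulVec_mulVec]
    exact this.symm
  change T *ᵥ (φ v) = φ (T *ᵥ v)
  rw [hX, hX, mulVec_mulVec, mulVec_mulVec, hc]

theorem mem_of_commute_centralizer {n : ℕ} (hn : 1 ≤ n)
    (B : Subalgebra ℝ (Matrix (Fin n) (Fin n) ℍ[ℝ]))
    (hirr : ∀ W : Submodule ℍ[ℝ]ᵐᵒᵖ (Fin n → ℍ[ℝ]),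
      (∀ A ∈ B, ∀ x ∈ W, A *ᵥ x ∈ W) → W = ⊥ ∨ W = ⊤)
    (T : Matrix (Fin n) (Fin n) ℍ[ℝ])
    (hT : ∀ X, (∀ b ∈ B, b * X = X * b) → T * X = X * T) : T ∈ B := by
  classical
  let s : Finset (Fin n → ℍ[ℝ]) := Finset.univ.biUnion fun j : Fin n =>
    {Pi.single j 1, op quaternionI • Pi.single j 1,
      op quaternionJ • Pi.single j 1, op quaternionK • Pi.single j 1}
  have hs : ∀ j : Fin n, Pi.single j 1 ∈ s ∧ op quaternionI • Pi.single j 1 ∈ s ∧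
      op quaternionJ • Pi.single j 1 ∈ s ∧ op quaternionK • Pi.single j 1 ∈ s := fun j => by
    refine ⟨?_, ?_, ?_, ?_⟩ <;> refine Finset.mem_biUnion.2 ⟨j, Finset.mem_univ j, ?_⟩ <;>
      simp only [Finset.mem_insert, Finset.mem_singleton, true_or, or_true]
  obtain ⟨r, hr⟩ := exists_moduleAux_eq_mulVec hn B hirr T hT s
  obtain ⟨b, hb, hb'⟩ := exists_mem_sum_smul B r
  have hTb : (4 : ℝ) • T = b := by
    have hcol : ∀ j, ((4 : ℝ) • T) *ᵥ (Pi.single j 1) = b *ᵥ (Pi.single j 1) := fun j => by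
      obtain ⟨h1, h2, h3, h4⟩ := hs j
      rw [← hb', ← hr _ h1, ← hr _ h2, ← hr _ h3, ← hr _ h4, mulVec_smul, mulVec_smul,
        mulVec_smul, smul_smul, smul_smul, smul_smul]
      ext1 i
      have := sum_mul_mul_star_quaternion 1
      simp only [mul_one] at this
      rw [smul_mulVec]
      simp only [Pi.add_apply, Pi.smul_apply, op_smul_eq_mul, ← op_mul]
      set t := (T *ᵥ Pi.single j 1) i
      calc (4 : ℝ) • t = t * ((4 * (1 : ℍ[ℝ]).re : ℝ) : ℍ[ℝ]) := by
            simp [Quaternion.mul_coe_eq_smul]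
        _ = _ := by rw [← this]; simp only [mul_add, mul_one]
    ext1 i j
    simpa using congr_fun (hcol j) i
  have : T = (4 : ℝ)⁻¹ • b := by rw [← hTb, inv_smul_smul₀ (by norm_num)]
  exact this ▸ B.smul_mem hb _

theorem quaternionI_mul_self : quaternionI * quaternionI = -1 := by
  ext <;> simp

theorem quaternionJ_mul_self : quaternionJ * quaternionJ = -1 := by
  ext <;> simp

theorem quaternionI_mul_quaternionJ :
    quaternionI * quaternionJ = -(quaternionJ * quaternionI) := by
  ext <;> simp

theorem mem_centralizer_quaternionI {q : ℍ[ℝ]} :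
    q ∈ Subalgebra.centralizer ℝ {quaternionI} ↔ q.imJ = 0 ∧ q.imK = 0 := by
  simp only [Subalgebra.mem_centralizer_iff, Set.mem_singleton_iff, forall_eq]
  rw [Quaternion.ext_iff]
  simp
  grind

theorem mem_centralizer_quaternionI_quaternionJ {q : ℍ[ℝ]} :
    q ∈ Subalgebra.centralizer ℝ {quaternionI, quaternionJ} ↔ ∃ r : ℝ, q = (r : ℍ[ℝ]) := by
  simp only [Subalgebra.mem_centralizer_iff, Set.mem_insert_iff, Set.mem_singleton_iff,
    forall_eq_or_imp, forall_eq]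
  simp only [Quaternion.ext_iff]
  simp
  grind

section Eigenvectors

variable {V : Type*} [AddCommGroup V] [Module ℍ[ℝ]ᵐᵒᵖ V]

theorem op_smul_op_smul_of_mul_self {q : ℍ[ℝ]} (hq : q * q = -1) (v : V) :
    op q • op q • v = -v := by
  rw [smul_smul, ← op_mul, hq, op_neg, op_one, neg_one_smul]

theorem op_quaternionJ_smul_op_quaternionI_smul (v : V) :
    op quaternionJ • op quaternionI • v = -(op quaternionI • op quaternionJ • v) := by
  rw [smul_smul, smul_smul, ← op_mul, ← op_mul, quaternionI_mul_quaternionJ, op_neg, neg_smul]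

theorem mem_of_add_mem_of_sub_mem {W : Submodule ℍ[ℝ]ᵐᵒᵖ V} {x y : V} (h₁ : x - y ∈ W)
    (h₂ : x + y ∈ W) : x ∈ W := by
  have h := W.smul_mem (2⁻¹ : ℍ[ℝ]ᵐᵒᵖ) (W.add_mem h₁ h₂)
  have e : x - y + (x + y) = (2 : ℍ[ℝ]ᵐᵒᵖ) • x := by rw [two_smul]; abel
  have h2 : (2 : ℍ[ℝ]ᵐᵒᵖ) ≠ 0 := fun h => by
    rw [← one_add_one_eq_two] at h
    have : (1 + 1 : ℍ[ℝ]).re = 0 := congrArg (fun q : ℍ[ℝ]ᵐᵒᵖ => (unop q).re) h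
    rw [Quaternion.re_add, Quaternion.re_one] at this
    norm_num at this
  rwa [e, inv_smul_smul₀ h2] at h

theorem span_eigenvectors_eq_top {J : V →ₗ[ℍ[ℝ]ᵐᵒᵖ] V} (hJ : ∀ v, J (J v) = -v) :
    Submodule.span ℍ[ℝ]ᵐᵒᵖ {v | J v = op quaternionI • v} = ⊤ := by
  have hI := op_smul_op_smul_of_mul_self (V := V) quaternionI_mul_self
  have hj := op_smul_op_smul_of_mul_self (V := V) quaternionJ_mul_self
  refine eq_top_iff.2 fun v _ => mem_of_add_mem_of_sub_mem (y := op quaternionI • J v) ?_ ?_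
  · refine Submodule.subset_span ?_
    simp only [Set.mem_ofPred_eq, map_sub, map_smul, hJ, smul_sub, hI, smul_neg]
    abel
  · rw [← neg_neg (v + _), ← hj]
    refine Submodule.smul_mem _ _ (Submodule.subset_span ?_)
    simp only [Set.mem_ofPred_eq, map_add, map_smul, map_neg, hJ, smul_add, hI, smul_neg,
      op_quaternionJ_smul_op_quaternionI_smul]
    simp only [← smul_neg]
    abel_nf

theorem span_joint_eigenvectors_eq_top {J K : V →ₗ[ℍ[ℝ]ᵐᵒᵖ] V} (hJ : ∀ v, J (J v) = -v)
    (hK : ∀ v, K (K v) = -v) (hJK : ∀ v, J (K v) = -K (J v)) :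
    Submodule.span ℍ[ℝ]ᵐᵒᵖ {v | J v = op quaternionI • v ∧ K v = op quaternionJ • v} = ⊤ := by
  have hI := op_smul_op_smul_of_mul_self (V := V) quaternionI_mul_self
  have hj := op_smul_op_smul_of_mul_self (V := V) quaternionJ_mul_self
  rw [← top_le_iff, ← span_eigenvectors_eq_top hJ, Submodule.span_le]
  intro w hw
  simp only [Set.mem_ofPred_eq] at hw
  refine mem_of_add_mem_of_sub_mem (y := op quaternionJ • K w) ?_ ?_
  · refine Submodule.subset_span ⟨?_, ?_⟩
    · simp only [map_sub, map_smul, hJK, hw, smul_sub, smul_neg,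
        op_quaternionJ_smul_op_quaternionI_smul, neg_neg]
    · simp only [map_sub, map_smul, hK, smul_sub, smul_neg, hj]
      abel
  · rw [← neg_neg (w + _), ← hI]
    refine Submodule.smul_mem _ _ (Submodule.subset_span ⟨?_, ?_⟩)
    · simp only [map_add, map_smul, map_neg, hJK, hw, smul_add, smul_neg,
        op_quaternionJ_smul_op_quaternionI_smul, neg_neg]
    · simp only [map_add, map_smul, map_neg, hK, smul_add, smul_neg,
        op_quaternionJ_smul_op_quaternionI_smul, hj, neg_neg]
      abel

end Eigenvectors

section Matrices

variable {n : ℕ}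

theorem exists_unit_col_mem_of_span_eq_top {s : Set (Fin n → ℍ[ℝ])}
    (hs : Submodule.span ℍ[ℝ]ᵐᵒᵖ s = ⊤) :
    ∃ P : (Matrix (Fin n) (Fin n) ℍ[ℝ])ˣ, ∀ j, P.val.col j ∈ s := by
  let b₀ := Module.Basis.ofSpan hs.ge
  let e : (Fin n → ℍ[ℝ]) ≃ₗ[ℍ[ℝ]ᵐᵒᵖ] (Fin n → ℍ[ℝ]ᵐᵒᵖ) :=
    { toFun := fun v i => op (v i)
      invFun := fun v i => unop (v i)
      map_add' := fun _ _ => rfl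
      map_smul' := fun _ _ => rfl
      left_inv := fun _ => rfl
      right_inv := fun _ => rfl }
  let b := b₀.reindex (b₀.indexEquiv (Module.Basis.ofEquivFun e))
  have hb : ∀ j, b j ∈ s := fun j => by
    rw [Module.Basis.reindex_apply]
    exact Module.Basis.ofSpan_subset hs.ge ⟨_, rfl⟩
  let P : Matrix (Fin n) (Fin n) ℍ[ℝ] := Matrix.of fun i j => b j i
  let Q : Matrix (Fin n) (Fin n) ℍ[ℝ] :=
    Matrix.of fun j i => unop (b.repr (Pi.single i 1) j)
  have hPQ : P * Q = 1 := by
    ext1 i k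
    have := congr_fun (b.sum_repr (Pi.single k 1)) i
    rw [Finset.sum_apply] at this
    rw [Matrix.mul_apply, Matrix.one_apply, ← Pi.single_apply, ← this]
    rfl
  exact ⟨⟨P, Q, hPQ, mul_eq_one_comm.1 hPQ⟩, hb⟩

theorem mul_eq_mul_diagonal_of_col {J P : Matrix (Fin n) (Fin n) ℍ[ℝ]} {q : ℍ[ℝ]}
    (h : ∀ j, J *ᵥ P.col j = op q • P.col j) : J * P = P * diagonal fun _ => q := by
  ext1 i j
  rw [mul_diagonal]
  exact congr_fun (h j) i

theorem commute_iff_conj_entries {J X : Matrix (Fin n) (Fin n) ℍ[ℝ]}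
    {P : (Matrix (Fin n) (Fin n) ℍ[ℝ])ˣ} {q : ℍ[ℝ]}
    (h : J * P.val = P.val * diagonal fun _ => q) :
    X * J = J * X ↔ ∀ i j, q * (P⁻¹.val * X * P.val) i j = (P⁻¹.val * X * P.val) i j * q := by
  have hJ : J = P.val * (diagonal fun _ => q) * P⁻¹.val := by
    rw [← h, mul_assoc, Units.mul_inv, mul_one]
  have h₁ : P⁻¹.val * X * P.val * (diagonal fun _ => q) = P⁻¹.val * (X * J) * P.val := by
    rw [hJ]; simp only [mul_assoc, Units.inv_mul, mul_one]
  have h₂ : (diagonal fun _ => q) * (P⁻¹.val * X * P.val) = P⁻¹.val * (J * X) * P.val := by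
    rw [hJ]; simp only [mul_assoc, Units.inv_mul_cancel_left]
  calc X * J = J * X ↔ P⁻¹.val * (X * J) * P.val = P⁻¹.val * (J * X) * P.val := by
        rw [Units.mul_left_inj, Units.mul_right_inj]
    _ ↔ _ := by
        rw [← h₁, ← h₂, ← Matrix.ext_iff]
        simp only [mul_diagonal, diagonal_mul, eq_comm]

/-- A nonzero two-sided ideal of the ring of matrices over a division subring of `ℍ` is
everything. -/
theorem mem_of_ideal_of_ne_zero {K : Subalgebra ℝ ℍ[ℝ]} (hK : ∀ q ∈ K, q⁻¹ ∈ K)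
    {I : AddSubgroup (Matrix (Fin n) (Fin n) ℍ[ℝ])}
    (hI : ∀ Y ∈ I, ∀ i j, Y i j ∈ K)
    (hl : ∀ X : Matrix (Fin n) (Fin n) ℍ[ℝ], (∀ i j, X i j ∈ K) → ∀ Y ∈ I, X * Y ∈ I)
    (hr : ∀ X : Matrix (Fin n) (Fin n) ℍ[ℝ], (∀ i j, X i j ∈ K) → ∀ Y ∈ I, Y * X ∈ I)
    {Y : Matrix (Fin n) (Fin n) ℍ[ℝ]} (hY : Y ∈ I) (hY0 : Y ≠ 0)
    {X : Matrix (Fin n) (Fin n) ℍ[ℝ]} (hX : ∀ i j, X i j ∈ K) : X ∈ I := by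
  obtain ⟨i, j, hij⟩ : ∃ i j, Y i j ≠ 0 := by
    by_contra! h
    exact hY0 (Matrix.ext h)
  have hsingle : ∀ (k l : Fin n) (q : ℍ[ℝ]), q ∈ K →
      ∀ a b, (Matrix.single k l q : Matrix (Fin n) (Fin n) ℍ[ℝ]) a b ∈ K := fun k l q hq a b => by
    rw [Matrix.single_apply]
    split_ifs
    exacts [hq, K.zero_mem]
  rw [Matrix.matrix_eq_sum_single X]
  refine I.sum_mem fun k _ => I.sum_mem fun l _ => ?_
  have h := hr _ (hsingle j l 1 K.one_mem) _
    (hl _ (hsingle k i (X k l * (Y i j)⁻¹) (K.mul_mem (hX k l) (hK _ (hI Y hY i j)))) Y hY)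
  rwa [Matrix.single_mul_mul_single, mul_one, inv_mul_cancel_right₀ hij] at h

theorem finrank_span_range_conj_single (P : (Matrix (Fin n) (Fin n) ℍ[ℝ])ˣ) (i : Fin n) :
    Module.finrank ℍ[ℝ]ᵐᵒᵖ (Submodule.span ℍ[ℝ]ᵐᵒᵖ
      (Set.range (P.val * Matrix.single i i 1 * P⁻¹.val).mulVec)) = 1 := by
  set v : Fin n → ℍ[ℝ] := P.val *ᵥ Pi.single i 1
  have hmul : ∀ x, (P.val * Matrix.single i i 1 * P⁻¹.val) *ᵥ x = op ((P⁻¹.val *ᵥ x) i) • v := by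
    intro x
    rw [← mulVec_mulVec, ← mulVec_mulVec, ← mulVec_smul]
    generalize P⁻¹.val *ᵥ x = y
    congr 1
    ext1 k
    simp [Matrix.single_mulVec, Pi.single_apply, Function.update_apply]
  have hinv : P⁻¹.val *ᵥ v = Pi.single i 1 := by
    rw [mulVec_mulVec, Units.inv_mul, one_mulVec]
  have hv : v ≠ 0 := by
    intro h
    rw [h, mulVec_zero] at hinv
    simpa using congr_fun hinv i
  have hspan : Submodule.span ℍ[ℝ]ᵐᵒᵖ
      (Set.range (P.val * Matrix.single i i 1 * P⁻¹.val).mulVec) =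
      Submodule.span ℍ[ℝ]ᵐᵒᵖ {v} := by
    apply le_antisymm
    · rw [Submodule.span_le]
      rintro _ ⟨x, rfl⟩
      rw [hmul]
      exact Submodule.smul_mem _ _ (Submodule.mem_span_singleton_self v)
    · rw [Submodule.span_singleton_le_iff_mem]
      refine Submodule.subset_span ⟨v, ?_⟩
      rw [hmul, hinv]
      simp
  rw [hspan]
  exact finrank_span_singleton hv

end Matrices

section Classification

variable {n : ℕ}

theorem isDomain_centralizer (hn : 1 ≤ n) {s : Set (Matrix (Fin n) (Fin n) ℍ[ℝ])}
    (hirr : ∀ W : Submodule ℍ[ℝ]ᵐᵒᵖ (Fin n → ℍ[ℝ]),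
      (∀ A ∈ s, ∀ x ∈ W, A *ᵥ x ∈ W) → W = ⊥ ∨ W = ⊤) :
    IsDomain (Subalgebra.centralizer ℝ s) := by
  have : Nonempty (Fin n) := ⟨⟨0, hn⟩⟩
  have hno : NoZeroDivisors (Subalgebra.centralizer ℝ s) := by
    refine ⟨fun {X Y} hXY => ?_⟩
    have hX := Subalgebra.mem_centralizer_iff ℝ |>.1 X.2
    have hXY : X.1 * Y.1 = 0 := congrArg Subtype.val hXY
    refine (hirr
      { carrier := {v | X.1 *ᵥ v = 0}
        add_mem' := fun {v w} hv hw => by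
          rw [Set.mem_ofPred_eq] at hv hw ⊢
          rw [mulVec_add, hv, hw, add_zero]
        zero_mem' := mulVec_zero _
        smul_mem' := fun q v hv => by
          rw [Set.mem_ofPred_eq] at hv ⊢
          rw [mulVec_smul, hv, smul_zero] } fun A hA v hv => ?_).symm.imp (fun h => ?_) fun h => ?_
    · change X.1 *ᵥ (A *ᵥ v) = 0
      change X.1 *ᵥ v = 0 at hv
      rw [mulVec_mulVec, ← hX A hA, ← mulVec_mulVec, hv, mulVec_zero]
    · refine Subtype.ext (Matrix.ext_iff_mulVec.2 fun v => ?_)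
      have : v ∈ (⊤ : Submodule ℍ[ℝ]ᵐᵒᵖ (Fin n → ℍ[ℝ])) := trivial
      rw [← h] at this
      exact Eq.trans this (zero_mulVec v).symm
    · refine Subtype.ext (Matrix.ext_iff_mulVec.2 fun v => ?_)
      have : Y.1 *ᵥ v ∈ (⊥ : Submodule ℍ[ℝ]ᵐᵒᵖ (Fin n → ℍ[ℝ])) := by
        rw [← h]
        change X.1 *ᵥ (Y.1 *ᵥ v) = 0
        rw [mulVec_mulVec, hXY, zero_mulVec]
      exact ((Submodule.mem_bot _).1 this).trans (zero_mulVec v).symm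
  exact NoZeroDivisors.to_isDomain _

theorem mulVec_mulVec_of_mul_self {J : Matrix (Fin n) (Fin n) ℍ[ℝ]} (hJ : J * J = -1)
    (v : Fin n → ℍ[ℝ]) : J *ᵥ (J *ᵥ v) = -v := by
  rw [mulVec_mulVec, hJ, neg_mulVec, one_mulVec]

theorem exists_conj_eq_diagonal {J : Matrix (Fin n) (Fin n) ℍ[ℝ]} (hJ : J * J = -1) :
    ∃ P : (Matrix (Fin n) (Fin n) ℍ[ℝ])ˣ,
      J * P.val = P.val * diagonal fun _ => quaternionI := by
  obtain ⟨P, hP⟩ := exists_unit_col_mem_of_span_eq_top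
    (span_eigenvectors_eq_top (J := mulVecBilin ℍ[ℝ] ℍ[ℝ]ᵐᵒᵖ J) (mulVec_mulVec_of_mul_self hJ))
  exact ⟨P, mul_eq_mul_diagonal_of_col hP⟩

theorem exists_conj_eq_diagonal_and_conj_eq_diagonal {J K : Matrix (Fin n) (Fin n) ℍ[ℝ]}
    (hJ : J * J = -1) (hK : K * K = -1) (hJK : J * K = -(K * J)) :
    ∃ P : (Matrix (Fin n) (Fin n) ℍ[ℝ])ˣ,
      J * P.val = P.val * (diagonal fun _ => quaternionI) ∧
      K * P.val = P.val * diagonal fun _ => quaternionJ := by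
  obtain ⟨P, hP⟩ := exists_unit_col_mem_of_span_eq_top
    (span_joint_eigenvectors_eq_top (J := mulVecBilin ℍ[ℝ] ℍ[ℝ]ᵐᵒᵖ J)
      (K := mulVecBilin ℍ[ℝ] ℍ[ℝ]ᵐᵒᵖ K) (mulVec_mulVec_of_mul_self hJ)
      (mulVec_mulVec_of_mul_self hK) fun v => by
        change J *ᵥ (K *ᵥ v) = -(K *ᵥ (J *ᵥ v))
        rw [mulVec_mulVec, hJK, neg_mulVec, mulVec_mulVec])
  exact ⟨P, mul_eq_mul_diagonal_of_col fun j => (hP j).1,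
    mul_eq_mul_diagonal_of_col fun j => (hP j).2⟩

/-- Up to conjugation, an irreducible unital algebra of quaternionic matrices consists of the
matrices with entries in the centralizer of some of the quaternion units. -/
theorem exists_conj_entries_mem_centralizer (hn : 1 ≤ n)
    (B : Subalgebra ℝ (Matrix (Fin n) (Fin n) ℍ[ℝ]))
    (hirr : ∀ W : Submodule ℍ[ℝ]ᵐᵒᵖ (Fin n → ℍ[ℝ]),
      (∀ A ∈ B, ∀ x ∈ W, A *ᵥ x ∈ W) → W = ⊥ ∨ W = ⊤) :
    ∃ (S : Set ℍ[ℝ]) (P : (Matrix (Fin n) (Fin n) ℍ[ℝ])ˣ),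
      (S = ∅ ∨ S = {quaternionI} ∨ S = {quaternionI, quaternionJ}) ∧
      ∀ X, X ∈ B ↔ ∀ i j, (P⁻¹.val * X * P.val) i j ∈ Subalgebra.centralizer ℝ S := by
  have hdom : IsDomain (Subalgebra.centralizer ℝ (B : Set (Matrix (Fin n) (Fin n) ℍ[ℝ]))) :=
    isDomain_centralizer hn hirr
  have hmem : ∀ (t : Subalgebra.centralizer ℝ (B : Set (Matrix (Fin n) (Fin n) ℍ[ℝ]))),
      ∀ X ∈ B, X * t.1 = t.1 * X := fun t => Subalgebra.mem_centralizer_iff ℝ |>.1 t.2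
  have hcomm := mem_of_commute_centralizer hn B hirr
  rcases frobenius_generators
    (Subalgebra.centralizer ℝ (B : Set (Matrix (Fin n) (Fin n) ℍ[ℝ]))) with
    h | ⟨J, hJ, h⟩ | ⟨J, K, hJ, hK, hJK, h⟩
  · refine ⟨∅, 1, Or.inl rfl, fun X => ⟨fun _ i j => ?_, fun _ => hcomm X fun Y hY => ?_⟩⟩
    · simp [Subalgebra.mem_centralizer_iff]
    · obtain ⟨a, ha⟩ := h ⟨Y, (Subalgebra.mem_centralizer_iff ℝ).2 hY⟩
      have ha : Y = algebraMap ℝ _ a := congrArg Subtype.val ha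
      rw [ha]
      exact (Algebra.commutes a X).symm
  · obtain ⟨P, hP⟩ := exists_conj_eq_diagonal (congrArg Subtype.val hJ)
    have hiff : ∀ X, X ∈ B ↔ X * J.1 = J.1 * X := fun X =>
      ⟨hmem J X, fun hX => hcomm X fun Y hY => by
        obtain ⟨a, b, ha⟩ := h ⟨Y, (Subalgebra.mem_centralizer_iff ℝ).2 hY⟩
        have ha : Y = algebraMap ℝ _ a + b • J.1 := congrArg Subtype.val ha
        rw [ha, mul_add, add_mul, Algebra.commutes, mul_smul_comm, smul_mul_assoc, hX]⟩
    refine ⟨{quaternionI}, P, Or.inr (Or.inl rfl), fun X => ?_⟩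
    rw [hiff, commute_iff_conj_entries hP]
    simp only [Subalgebra.mem_centralizer_iff, Set.mem_singleton_iff, forall_eq]
  · obtain ⟨P, hPJ, hPK⟩ := exists_conj_eq_diagonal_and_conj_eq_diagonal
      (congrArg Subtype.val hJ) (congrArg Subtype.val hK) (congrArg Subtype.val hJK)
    have hiff : ∀ X, X ∈ B ↔ X * J.1 = J.1 * X ∧ X * K.1 = K.1 * X := fun X =>
      ⟨fun hX => ⟨hmem J X hX, hmem K X hX⟩, fun hX => hcomm X fun Y hY => by
        obtain ⟨a, b, c, d, ha⟩ := h ⟨Y, (Subalgebra.mem_centralizer_iff ℝ).2 hY⟩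
        have ha : Y = algebraMap ℝ _ a + b • J.1 + c • K.1 + d • (K.1 * J.1) :=
          congrArg Subtype.val ha
        have hKJ : X * (K.1 * J.1) = K.1 * J.1 * X := by
          rw [← mul_assoc, hX.2, mul_assoc, hX.1, mul_assoc]
        simp only [ha, mul_add, add_mul, Algebra.commutes, mul_smul_comm, smul_mul_assoc, hX, hKJ]⟩
    refine ⟨{quaternionI, quaternionJ}, P, Or.inr (Or.inr rfl), fun X => ?_⟩
    rw [hiff, commute_iff_conj_entries hPJ, commute_iff_conj_entries hPK]
    simp only [Subalgebra.mem_centralizer_iff, Set.mem_insert_iff, Set.mem_singleton_iff,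
      forall_eq_or_imp, forall_eq, forall_and]

theorem inv_mem_centralizer {S : Set ℍ[ℝ]} {q : ℍ[ℝ]} (hq : q ∈ Subalgebra.centralizer ℝ S) :
    q⁻¹ ∈ Subalgebra.centralizer ℝ S :=
  Set.inv_mem_centralizer₀ hq

theorem mul_mem_and_mul_mem_of_mem_adjoin {R A : Type*} [CommSemiring R] [Semiring A]
    [Algebra R A] (𝒜 : NonUnitalSubalgebra R A) {x y : A}
    (hx : x ∈ Algebra.adjoin R (𝒜 : Set A)) (hy : y ∈ 𝒜) : x * y ∈ 𝒜 ∧ y * x ∈ 𝒜 := by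
  induction hx using Algebra.adjoin_induction generalizing y with
  | mem x hx => exact ⟨𝒜.mul_mem hx hy, 𝒜.mul_mem hy hx⟩
  | algebraMap r =>
    rw [← Algebra.commutes, Algebra.algebraMap_eq_smul_one, smul_one_mul]
    exact ⟨𝒜.smul_mem r hy, 𝒜.smul_mem r hy⟩
  | add x x' _ _ hx hx' =>
    rw [add_mul, mul_add]
    exact ⟨𝒜.add_mem (hx hy).1 (hx' hy).1, 𝒜.add_mem (hx hy).2 (hx' hy).2⟩
  | mul x x' _ _ hx hx' =>
    rw [mul_assoc, ← mul_assoc y]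
    exact ⟨(hx (hx' hy).1).1, (hx' (hx hy).2).2⟩

/-- Up to conjugation, an irreducible algebra of quaternionic matrices consists of the
matrices with entries in the centralizer of some of the quaternion units. -/
theorem exists_conj_entries_mem_centralizer_of_nonUnital (hn : 1 ≤ n)
    (𝒜 : NonUnitalSubalgebra ℝ (Matrix (Fin n) (Fin n) ℍ[ℝ]))
    (hne : (𝒜 : Set (Matrix (Fin n) (Fin n) ℍ[ℝ])) ≠ {0})
    (hirr : ∀ W : Submodule ℍ[ℝ]ᵐᵒᵖ (Fin n → ℍ[ℝ]),
      (∀ A ∈ 𝒜, ∀ x ∈ W, A *ᵥ x ∈ W) → W = ⊥ ∨ W = ⊤) :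
    ∃ (S : Set ℍ[ℝ]) (P : (Matrix (Fin n) (Fin n) ℍ[ℝ])ˣ),
      (S = ∅ ∨ S = {quaternionI} ∨ S = {quaternionI, quaternionJ}) ∧
      ∀ X, X ∈ 𝒜 ↔ ∀ i j, (P⁻¹.val * X * P.val) i j ∈ Subalgebra.centralizer ℝ S := by
  have hsub := Algebra.subset_adjoin (R := ℝ) (s := (𝒜 : Set (Matrix (Fin n) (Fin n) ℍ[ℝ])))
  obtain ⟨S, P, hS, hP⟩ := exists_conj_entries_mem_centralizer hn
    (Algebra.adjoin ℝ (𝒜 : Set (Matrix (Fin n) (Fin n) ℍ[ℝ])))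
    fun W hW => hirr W fun A hA => hW A (hsub hA)
  have hconj : ∀ Y : Matrix (Fin n) (Fin n) ℍ[ℝ],
      P⁻¹.val * (P.val * Y * P⁻¹.val) * P.val = Y := fun Y => by
    simp only [mul_assoc, Units.inv_mul_cancel_left, Units.inv_mul, mul_one]
  have hconj' : ∀ Y : Matrix (Fin n) (Fin n) ℍ[ℝ],
      P.val * (P⁻¹.val * Y * P.val) * P⁻¹.val = Y := fun Y => by
    simp only [mul_assoc, Units.mul_inv_cancel_left, Units.mul_inv, mul_one]
  have hmul : ∀ X Y : Matrix (Fin n) (Fin n) ℍ[ℝ], P.val * (X * Y) * P⁻¹.val =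
      P.val * X * P⁻¹.val * (P.val * Y * P⁻¹.val) := fun X Y => by
    simp only [mul_assoc, Units.inv_mul_cancel_left]
  have hadj : ∀ X : Matrix (Fin n) (Fin n) ℍ[ℝ],
      (∀ i j, X i j ∈ Subalgebra.centralizer ℝ S) →
      P.val * X * P⁻¹.val ∈ Algebra.adjoin ℝ (𝒜 : Set (Matrix (Fin n) (Fin n) ℍ[ℝ])) :=
    fun X hX => (hP _).2 (by rwa [hconj])
  let I : AddSubgroup (Matrix (Fin n) (Fin n) ℍ[ℝ]) :=
    { carrier := {Y | P.val * Y * P⁻¹.val ∈ 𝒜}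
      add_mem' := fun {X Y} hX hY => by
        rw [Set.mem_ofPred_eq, mul_add, add_mul]
        exact 𝒜.add_mem hX hY
      zero_mem' := by
        rw [Set.mem_ofPred_eq, mul_zero, zero_mul]
        exact 𝒜.zero_mem
      neg_mem' := fun {X} hX => by
        rw [Set.mem_ofPred_eq, mul_neg, neg_mul]
        exact neg_mem (S := NonUnitalSubalgebra ℝ _) hX }
  obtain ⟨A, hA, hA0⟩ : ∃ A ∈ 𝒜, A ≠ 0 := by
    by_contra! h
    exact hne (Set.eq_singleton_iff_unique_mem.2 ⟨𝒜.zero_mem, h⟩)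
  refine ⟨S, P, hS, fun X => ⟨fun hX => (hP X).1 (hsub hX), fun hX => ?_⟩⟩
  have hXI : P⁻¹.val * X * P.val ∈ I := by
    refine mem_of_ideal_of_ne_zero (K := Subalgebra.centralizer ℝ S)
      (Y := P⁻¹.val * A * P.val) (fun q => inv_mem_centralizer) (fun Y hY => ?_)
      (fun X hX Y hY => ?_) (fun X hX Y hY => ?_) ?_ (fun h => hA0 ?_) hX
    · have := (hP _).1 (hsub hY)
      rwa [hconj] at this
    · change P.val * (X * Y) * P⁻¹.val ∈ 𝒜
      rw [hmul]
      exact (mul_mem_and_mul_mem_of_mem_adjoin 𝒜 (hadj X hX) hY).1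
    · change P.val * (Y * X) * P⁻¹.val ∈ 𝒜
      rw [hmul]
      exact (mul_mem_and_mul_mem_of_mem_adjoin 𝒜 (hadj X hX) hY).2
    · change P.val * (P⁻¹.val * A * P.val) * P⁻¹.val ∈ 𝒜
      rwa [hconj']
    · rw [← hconj' A, h, mul_zero, zero_mul]
  rw [← hconj' X]
  exact hXI

theorem image_conj_eq_of_mem_iff {s : Set (Matrix (Fin n) (Fin n) ℍ[ℝ])}
    {P : (Matrix (Fin n) (Fin n) ℍ[ℝ])ˣ} {p : Matrix (Fin n) (Fin n) ℍ[ℝ] → Prop}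
    (h : ∀ X, X ∈ s ↔ p (P⁻¹.val * X * P.val)) :
    (fun X => P⁻¹.val * X * P.val) '' s = {X | p X} := by
  ext Y
  refine ⟨?_, fun hY => ⟨P.val * Y * P⁻¹.val, (h _).2 ?_, ?_⟩⟩
  · rintro ⟨X, hX, rfl⟩
    exact (h X).1 hX
  · have hY : p Y := hY
    simpa only [mul_assoc, Units.inv_mul_cancel_left, Units.inv_mul, mul_one] using hY
  · simp only [mul_assoc, Units.inv_mul_cancel_left, Units.inv_mul, mul_one]

end Classification

end

/-- An irreducible ℝ-subalgebra of `Mₙ(ℍ)` contains a rank-one matrix, and is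
`Mₙ(ℍ)`, or similar to `Mₙ(ℂ)` (entries in `ℝ + ℝi`), or similar to `Mₙ(ℝ)`. -/
theorem irreducible_real_subalgebra_of_quaternion_classification
    (n : ℕ) (hn : 1 ≤ n)
    (𝒜 : NonUnitalSubalgebra ℝ (Matrix (Fin n) (Fin n) (Quaternion ℝ)))
    -- `𝒜` is irreducible: no nontrivial invariant right ℍ-subspace
    (hne : (𝒜 : Set (Matrix (Fin n) (Fin n) (Quaternion ℝ))) ≠ {0})
    (hirr : ∀ W : Submodule (Quaternion ℝ)ᵐᵒᵖ (Fin n → Quaternion ℝ),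
      (∀ A ∈ 𝒜, ∀ x ∈ W, A.mulVec x ∈ W) → W = ⊥ ∨ W = ⊤) :
    -- `𝒜` contains a matrix of rank one (image is a one-dimensional right ℍ-subspace)
    (∃ A ∈ 𝒜, Module.finrank (Quaternion ℝ)ᵐᵒᵖ
      (Submodule.span (Quaternion ℝ)ᵐᵒᵖ (Set.range A.mulVec)) = 1) ∧
    -- trichotomy
    (𝒜 = ⊤ ∨
     (∃ P : (Matrix (Fin n) (Fin n) (Quaternion ℝ))ˣ,
       (fun X => (P⁻¹).val * X * P.val) '' (𝒜 : Set (Matrix (Fin n) (Fin n) (Quaternion ℝ))) =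
         {X : Matrix (Fin n) (Fin n) (Quaternion ℝ) |
           ∀ i j, (X i j).imJ = 0 ∧ (X i j).imK = 0}) ∨
     (∃ P : (Matrix (Fin n) (Fin n) (Quaternion ℝ))ˣ,
       (fun X => (P⁻¹).val * X * P.val) '' (𝒜 : Set (Matrix (Fin n) (Fin n) (Quaternion ℝ))) =
         {X : Matrix (Fin n) (Fin n) (Quaternion ℝ) |
           ∀ i j, ∃ r : ℝ, X i j = (r : Quaternion ℝ)})) := by
  obtain ⟨S, P, hS, hP⟩ := exists_conj_entries_mem_centralizer_of_nonUnital hn 𝒜 hne hirr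
  have hP₀ : P.val * Matrix.single (⟨0, hn⟩ : Fin n) ⟨0, hn⟩ 1 * P⁻¹.val ∈ 𝒜 := by
    rw [hP]
    intro i j
    simp only [mul_assoc, Units.inv_mul_cancel_left, Units.inv_mul, mul_one, Matrix.single_apply]
    split_ifs
    exacts [one_mem _, zero_mem _]
  refine ⟨⟨_, hP₀, finrank_span_range_conj_single P _⟩, ?_⟩
  rcases hS with rfl | rfl | rfl
  · refine Or.inl (NonUnitalSubalgebra.ext fun X => ?_)
    rw [hP]
    simp [Subalgebra.mem_centralizer_iff]
  · simp only [mem_centralizer_quaternionI] at hP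
    exact Or.inr (Or.inl ⟨P, image_conj_eq_of_mem_iff hP⟩)
  · simp only [mem_centralizer_quaternionI_quaternionJ] at hP
    exact Or.inr (Or.inr ⟨P, image_conj_eq_of_mem_iff hP⟩)
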